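/- arXiv:1406.0096 — 2 statements merged into one kernel-verified Lean document; each statement's English description precedes it below -/
import Mathlib

section
/- Let P_Θ be a locally finite marked point set in ℝ² satisfying Conditions D, and define the T₁-iterates f₀:=0, f_{n+1}:=T₁f_n with monotone limits f and g. Then f is a GMHS function of Type 1 based on P_Θ if and only if f = g, in which case f is the unique GMHS function of Type 1 based on P_Θ. -/
open scoped ENNReal
open Real

noncomputable section

namespace Lilypond

/-- Points of the Euclidean plane. -/
abbrev Pt := EuclideanSpace ℝ (Fin 2)

/-- A marked point: a centre in the plane together with a direction. -/
abbrev MPt := Pt × ℝ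

/-- The unit vector in direction `θ`. -/
def dirVec (θ : ℝ) : Pt := (WithLp.equiv 2 (Fin 2 → ℝ)).symm ![Real.cos θ, Real.sin θ]

/-- The full line through the centre of `p` in the direction of `p`. -/
def lineThru (p : MPt) : Set Pt := {q | ∃ t : ℝ, q = p.1 + t • dirVec p.2}

open Classical in
/-- A point of intersection of the lines through `i` and `j` (junk value if disjoint). -/
def interPt (i j : MPt) : Pt :=
  if h : (lineThru i ∩ lineThru j).Nonempty then h.choose else 0

open Classical in
/-- The distance `dᵢⱼ` from the centre of `i` to the intersection point of the lines
through `i` and `j`; if the directions coincide it is half the distance between the centres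
when `j` lies on the line through `i`, and `∞` otherwise. -/
def dD (i j : MPt) : ℝ≥0∞ :=
  if i.2 = j.2 then
    (if j.1 ∈ lineThru i then edist i.1 j.1 / 2 else ⊤)
  else edist i.1 (interPt i j)

/-- `A` is a locally finite marked point set: all directions lie in `[0, π)` and only finitely
many centres lie in any bounded region. -/
def MarkedLocFin (A : Set MPt) : Prop :=
  (∀ p ∈ A, p.2 ∈ Set.Ico 0 Real.pi) ∧
    ∀ B : Set Pt, Bornology.IsBounded B → {p ∈ A | p.1 ∈ B}.Finite

/-- Conditions D: all finite distances `dᵢⱼ` (`i ≠ j`) are mutually distinct. -/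
def CondD (A : Set MPt) : Prop :=
  ∀ i ∈ A, ∀ j ∈ A, ∀ k ∈ A, ∀ l ∈ A,
    i ≠ j → k ≠ l → (i, j) ≠ (k, l) → dD i j ≠ ⊤ → dD k l ≠ ⊤ → dD i j ≠ dD k l

/-- The set `Dᵢ(f)` of Model 1. -/
def D1 (A : Set MPt) (f : MPt → ℝ≥0∞) (i : MPt) : Set ℝ≥0∞ :=
  {x | ∃ j ∈ A, j ≠ i ∧ x = dD i j ∧ dD j i < dD i j ∧ dD j i < f j}

/-- The operator `T₁` of Model 1 (with `sInf ∅ = ∞`). -/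
def T1 (A : Set MPt) (f : MPt → ℝ≥0∞) (i : MPt) : ℝ≥0∞ := sInf (D1 A f i)

/-- The set `D⁽²⁾ᵢ(f)` of Model 2. -/
def D2 (A : Set MPt) (f : MPt → ℝ≥0∞) (i : MPt) : Set ℝ≥0∞ :=
  {x | ∃ j ∈ A, j ≠ i ∧ x = max (dD i j) (dD j i) ∧ dD j i ≤ f j}

/-- The operator `T₂` of Model 2 (with `sInf ∅ = ∞`). -/
def T2 (A : Set MPt) (f : MPt → ℝ≥0∞) (i : MPt) : ℝ≥0∞ := sInf (D2 A f i)

/-- The relative interior of the segment of half-length `r` centred at `p`. -/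
def S0 (p : MPt) (r : ℝ≥0∞) : Set Pt :=
  {q | ∃ t : ℝ, ENNReal.ofReal |t| < r ∧ q = p.1 + t • dirVec p.2}

/-- `f` is a hard-segment (HS) function on `A`. -/
def IsHS (A : Set MPt) (f : MPt → ℝ≥0∞) : Prop :=
  ∀ i ∈ A, ∀ j ∈ A, i ≠ j → Disjoint (S0 i (f i)) (S0 j (f j))

/-- `j` is a Type 1 stopping segment neighbour of `i` for `f`. -/
def StopNbr1 (A : Set MPt) (f : MPt → ℝ≥0∞) (i j : MPt) : Prop :=
  j ∈ A ∧ j ≠ i ∧ f i = dD i j ∧ dD j i < dD i j ∧ dD j i < f j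

/-- `f` is a GMHS function of Type 1 on `A`. -/
def IsGMHS1 (A : Set MPt) (f : MPt → ℝ≥0∞) : Prop :=
  IsHS A f ∧ ∀ i ∈ A, f i < ⊤ → ∃ j, StopNbr1 A f i j

/-- `j` is a Type 2 stopping segment neighbour of `i` for `f`. -/
def StopNbr2 (A : Set MPt) (f : MPt → ℝ≥0∞) (i j : MPt) : Prop :=
  j ∈ A ∧ j ≠ i ∧ f i = max (dD i j) (dD j i) ∧ dD j i ≤ f j

/-- `f` is a GMHS function of Type 2 on `A`. -/
def IsGMHS2 (A : Set MPt) (f : MPt → ℝ≥0∞) : Prop :=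
  IsHS A f ∧ ∀ i ∈ A, f i < ⊤ → ∃ j, StopNbr2 A f i j

/-- `A` has a descending chain of Type 1. -/
def HasDescChain1 (A : Set MPt) : Prop :=
  ∃ P : ℕ → MPt, (∀ n, P n ∈ A) ∧ Function.Injective P ∧
    dD (P 0) (P 1) < ⊤ ∧
    ∀ n : ℕ, dD (P (n+1)) (P n) ≤ dD (P n) (P (n+1)) ∧
      dD (P (n+1)) (P (n+2)) ≤ dD (P (n+1)) (P n)

/-- `A` has a descending chain of Type 2. -/
def HasDescChain2 (A : Set MPt) : Prop :=
  ∃ P : ℕ → MPt, (∀ n, P n ∈ A) ∧ Function.Injective P ∧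
    dD (P 1) (P 0) < ⊤ ∧
    ∀ n : ℕ, max (dD (P (n+1)) (P (n+2))) (dD (P (n+2)) (P (n+1))) ≤ dD (P (n+1)) (P n)

/-- The `T₁`-iterates `f₀ := 0`, `f_{n+1} := T₁ f_n`. -/
def iter1 (A : Set MPt) : ℕ → MPt → ℝ≥0∞
  | 0 => fun _ => 0
  | n + 1 => T1 A (iter1 A n)

/-- The monotone limit `f` of the even `T₁`-iterates. -/
def limEven1 (A : Set MPt) (p : MPt) : ℝ≥0∞ := ⨆ n, iter1 A (2 * n) p

/-- The monotone limit `g` of the odd `T₁`-iterates. -/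
def limOdd1 (A : Set MPt) (p : MPt) : ℝ≥0∞ := ⨅ n, iter1 A (2 * n + 1) p

/-- The `T₂`-iterates `f₀ := 0`, `f_{n+1} := T₂ f_n`. -/
def iter2 (A : Set MPt) : ℕ → MPt → ℝ≥0∞
  | 0 => fun _ => 0
  | n + 1 => T2 A (iter2 A n)

/-- The monotone limit `f` of the even `T₂`-iterates. -/
def limEven2 (A : Set MPt) (p : MPt) : ℝ≥0∞ := ⨆ n, iter2 A (2 * n) p

/-- The monotone limit `g` of the odd `T₂`-iterates. -/
def limOdd2 (A : Set MPt) (p : MPt) : ℝ≥0∞ := ⨅ n, iter2 A (2 * n + 1) p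


/-- The point with parameter `t` on a line is at distance `|t|` from the centre. -/
theorem edist_add_smul_dirVec (P : Pt) (t θ : ℝ) :
    edist P (P + t • dirVec θ) = ENNReal.ofReal |t| := by
  have hu : ‖dirVec θ‖ = 1 := by
    simp [dirVec, EuclideanSpace.norm_eq, Fin.sum_univ_two]
  rw [edist_dist, dist_self_add_right, norm_smul, hu, mul_one, Real.norm_eq_abs]

theorem mem_S0_iff {p : MPt} {r : ℝ≥0∞} {q : Pt} :
    q ∈ S0 p r ↔ q ∈ lineThru p ∧ edist p.1 q < r := by
  constructor
  · rintro ⟨t, ht, rfl⟩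
    exact ⟨⟨t, rfl⟩, by rwa [edist_add_smul_dirVec]⟩
  · rintro ⟨⟨t, rfl⟩, ht⟩
    exact ⟨t, by rwa [edist_add_smul_dirVec] at ht, rfl⟩

theorem sin_sub_ne_zero_of_mem_Ico {a b : ℝ} (ha : a ∈ Set.Ico 0 π) (hb : b ∈ Set.Ico 0 π)
    (hab : a ≠ b) : Real.sin (b - a) ≠ 0 := by
  intro h
  have := (Real.sin_eq_zero_iff_of_lt_of_lt (by linarith [ha.2, hb.1])
    (by linarith [hb.2, ha.1])).1 h
  exact hab (by linarith)

theorem lineThru_inter_nonempty {i j : MPt} (h : Real.sin (j.2 - i.2) ≠ 0) :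
    (lineThru i ∩ lineThru j).Nonempty := by
  rw [Real.sin_sub] at h
  set D := Real.sin j.2 * Real.cos i.2 - Real.cos j.2 * Real.sin i.2 with hDef
  refine ⟨i.1 + (((j.1 0 - i.1 0) * Real.sin j.2 - (j.1 1 - i.1 1) * Real.cos j.2) / D) •
    dirVec i.2, ⟨_, rfl⟩,
    ((j.1 0 - i.1 0) * Real.sin i.2 - (j.1 1 - i.1 1) * Real.cos i.2) / D, ?_⟩
  ext k
  fin_cases k
  · simp [dirVec]
    field_simp
    rw [hDef]
    ring
  · simp [dirVec]
    field_simp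
    rw [hDef]
    ring

theorem lineThru_inter_subsingleton {i j : MPt} (h : Real.sin (j.2 - i.2) ≠ 0) :
    (lineThru i ∩ lineThru j).Subsingleton := by
  rintro _ ⟨⟨t, rfl⟩, ⟨s, hs⟩⟩ _ ⟨⟨t', rfl⟩, ⟨s', hs'⟩⟩
  have a0 := congrArg (fun v : Pt => v 0) hs
  have a1 := congrArg (fun v : Pt => v 1) hs
  have b0 := congrArg (fun v : Pt => v 0) hs'
  have b1 := congrArg (fun v : Pt => v 1) hs'
  simp [dirVec] at a0 a1 b0 b1
  rw [Real.sin_sub] at h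
  have : (t - t') * (Real.sin j.2 * Real.cos i.2 - Real.cos j.2 * Real.sin i.2) = 0 := by
    linear_combination Real.sin j.2 * a0 - Real.cos j.2 * a1 - Real.sin j.2 * b0 +
      Real.cos j.2 * b1
  rcases mul_eq_zero.1 this with h' | h'
  · rw [sub_eq_zero.1 h']
  · exact absurd h' h

theorem interPt_mem {i j : MPt} (h : (lineThru i ∩ lineThru j).Nonempty) :
    interPt i j ∈ lineThru i ∩ lineThru j := by
  rw [interPt, dif_pos h]
  exact h.choose_spec

theorem interPt_comm (i j : MPt) : interPt i j = interPt j i := by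
  unfold interPt
  rw! [Set.inter_comm (lineThru i) (lineThru j)]
  rfl

theorem mem_lineThru_comm {i j : MPt} (h : i.2 = j.2) :
    j.1 ∈ lineThru i ↔ i.1 ∈ lineThru j := by
  constructor
  · rintro ⟨t, ht⟩
    exact ⟨-t, by rw [ht, h]; module⟩
  · rintro ⟨t, ht⟩
    exact ⟨-t, by rw [ht, h]; module⟩

theorem dD_comm_of_eq {i j : MPt} (h : i.2 = j.2) : dD i j = dD j i := by
  rw [dD, dD, if_pos h, if_pos h.symm, edist_comm i.1]
  by_cases hj : j.1 ∈ lineThru i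
  · rw [if_pos hj, if_pos ((mem_lineThru_comm h).1 hj)]
  · rw [if_neg hj, if_neg (mt (mem_lineThru_comm h).2 hj)]

theorem edist_le_dD_add_dD (i j : MPt) : edist i.1 j.1 ≤ dD i j + dD j i := by
  by_cases h : i.2 = j.2
  · rw [← dD_comm_of_eq h, dD, if_pos h]
    split_ifs
    · rw [ENNReal.add_halves]
    · simp
  · rw [dD, dD, if_neg h, if_neg (Ne.symm h), interPt_comm j i, edist_comm j.1]
    exact edist_triangle _ _ _

theorem CondD.dD_ne {A : Set MPt} (hD : CondD A) {i j : MPt} (hi : i ∈ A) (hj : j ∈ A)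
    (hij : i ≠ j) (h : dD i j ≠ ⊤) : dD i j ≠ dD j i := fun he =>
  hD i hi j hj j hj i hi hij hij.symm (fun e => hij (congrArg Prod.fst e)) h (he ▸ h) he

theorem not_disjoint_S0_iff {A : Set MPt} (hA : MarkedLocFin A) (hD : CondD A) {i j : MPt}
    (hi : i ∈ A) (hj : j ∈ A) (hij : i ≠ j) (r s : ℝ≥0∞) :
    ¬ Disjoint (S0 i r) (S0 j s) ↔ dD i j < r ∧ dD j i < s := by
  rw [Set.not_disjoint_iff]
  simp only [mem_S0_iff]
  by_cases h : i.2 = j.2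
  · have hc := dD_comm_of_eq h
    have htop : dD i j = ⊤ := by
      by_contra hne
      exact hD.dD_ne hi hj hij hne hc
    constructor
    · rintro ⟨q, ⟨⟨t, ht⟩, -⟩, ⟨t', ht'⟩, -⟩
      have hline : j.1 ∈ lineThru i := by
        refine ⟨t - t', ?_⟩
        rw [ht, ← h] at ht'
        rw [sub_smul, ← add_sub_assoc, ht', add_sub_cancel_right]
      rw [dD, if_pos h, if_pos hline] at htop
      exact absurd htop (ENNReal.div_ne_top (edist_ne_top _ _) two_ne_zero)
    · rintro ⟨hr, -⟩
      rw [htop] at hr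
      exact absurd hr not_top_lt
  · have hs := sin_sub_ne_zero_of_mem_Ico (hA.1 i hi) (hA.1 j hj) h
    have hm := interPt_mem (lineThru_inter_nonempty hs)
    rw [dD, dD, if_neg h, if_neg (Ne.symm h), interPt_comm j i]
    constructor
    · rintro ⟨q, ⟨hqi, hr⟩, hqj, hr'⟩
      rw [lineThru_inter_subsingleton hs hm ⟨hqi, hqj⟩]
      exact ⟨hr, hr'⟩
    · rintro ⟨hr, hr'⟩
      exact ⟨_, ⟨hm.1, hr⟩, hm.2, hr'⟩

theorem T1_anti {A : Set MPt} {f g : MPt → ℝ≥0∞} (h : ∀ p ∈ A, f p ≤ g p) (i : MPt) :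
    T1 A g i ≤ T1 A f i := by
  refine sInf_le_sInf ?_
  rintro x ⟨j, hj, hji, hx, h1, h2⟩
  exact ⟨j, hj, hji, hx, h1, h2.trans_le (h j hj)⟩

/-- The infimum defining `T₁ f` is attained whenever it is finite. -/
theorem T1_mem_D1 {A : Set MPt} (hA : MarkedLocFin A) {f : MPt → ℝ≥0∞} {i : MPt}
    (h : T1 A f i < ⊤) : T1 A f i ∈ D1 A f i := by
  obtain ⟨x, hx, hxtop⟩ := sInf_lt_iff.1 h
  have hfin : (D1 A f i ∩ Set.Iic x).Finite := by
    refine ((hA.2 _ (Metric.isBounded_closedBall (x := i.1) (r := (x + x).toReal))).image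
      (dD i)).subset ?_
    rintro y ⟨⟨j, hj, -, rfl, hlt, -⟩, hy⟩
    refine ⟨j, ⟨hj, ?_⟩, rfl⟩
    rw [Metric.mem_closedBall', dist_edist]
    exact ENNReal.toReal_mono (ENNReal.add_ne_top.2 ⟨hxtop.ne, hxtop.ne⟩)
      ((edist_le_dD_add_dD i j).trans (add_le_add hy (hlt.le.trans hy)))
  obtain ⟨m, ⟨hm, hmx⟩, hmin⟩ := Set.exists_min_image _ id hfin ⟨x, hx, le_refl x⟩
  have : T1 A f i = m := by
    refine le_antisymm (sInf_le hm) (le_sInf fun y hy => ?_)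
    rcases le_total y x with hyx | hxy
    · exact hmin y ⟨hy, hyx⟩
    · exact le_trans hmx hxy
  rwa [this]

/-- The GMHS functions of Type 1 are the fixed points of `T₁`. -/
theorem isGMHS1_iff {A : Set MPt} (hA : MarkedLocFin A) (hD : CondD A) (h : MPt → ℝ≥0∞) :
    IsGMHS1 A h ↔ Set.EqOn (T1 A h) h A := by
  constructor
  · rintro ⟨hs, hn⟩ i hi
    refine le_antisymm ?_ (le_sInf ?_)
    · rcases eq_or_ne (h i) ⊤ with ht | ht
      · rw [ht]
        exact le_top
      · obtain ⟨j, hj, hji, he, h1, h2⟩ := hn i hi ht.lt_top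
        exact sInf_le ⟨j, hj, hji, he, h1, h2⟩
    · rintro _ ⟨j, hj, hji, rfl, -, h2⟩
      by_contra! hlt
      exact (not_disjoint_S0_iff hA hD hi hj hji.symm _ _).2 ⟨hlt, h2⟩ (hs i hi j hj hji.symm)
  · intro hfix
    have key : ∀ i ∈ A, ∀ j ∈ A, i ≠ j → dD j i < dD i j → dD j i < h j → ¬ dD i j < h i := by
      intro i hi j hj hij h1 h2
      rw [not_lt, ← hfix hi]
      exact sInf_le ⟨j, hj, hij.symm, rfl, h1, h2⟩
    refine ⟨fun i hi j hj hij => ?_, fun i hi hlt => ?_⟩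
    · by_contra hnd
      obtain ⟨h1, h2⟩ := (not_disjoint_S0_iff hA hD hi hj hij _ _).1 hnd
      rcases lt_or_gt_of_ne (hD.dD_ne hi hj hij h1.ne_top) with hlt | hlt
      · exact key j hj i hi hij.symm hlt h1 h2
      · exact key i hi j hj hij hlt h2 h1
    · rw [← hfix hi] at hlt
      obtain ⟨j, hj, hji, he, h1, h2⟩ := T1_mem_D1 hA hlt
      exact ⟨j, hj, hji, (hfix hi).symm.trans he, h1, h2⟩

/-- The operator `T₁` sends the limit of the even iterates to the limit of the odd iterates. -/
theorem T1_limEven1 (A : Set MPt) (i : MPt) : T1 A (limEven1 A) i = limOdd1 A i := by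
  refine le_antisymm (le_iInf fun n => ?_) (le_sInf ?_)
  · exact T1_anti (fun p _ => le_iSup (fun n => iter1 A (2 * n) p) n) i
  · rintro x ⟨j, hj, hji, rfl, h1, h2⟩
    obtain ⟨n, hn⟩ := lt_iSup_iff.1 h2
    exact (iInf_le _ n).trans (sInf_le ⟨j, hj, hji, rfl, h1, hn⟩)

theorem iter1_bounds {A : Set MPt} {h : MPt → ℝ≥0∞} (hfix : Set.EqOn (T1 A h) h A) (n : ℕ) :
    (∀ p ∈ A, iter1 A (2 * n) p ≤ h p) ∧ ∀ p ∈ A, h p ≤ iter1 A (2 * n + 1) p := by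
  have step : ∀ m, (∀ p ∈ A, iter1 A m p ≤ h p) → ∀ p ∈ A, h p ≤ iter1 A (m + 1) p :=
    fun m hm p hp => (hfix hp).symm.le.trans (T1_anti hm p)
  induction n with
  | zero => exact ⟨fun p _ => zero_le, step 0 fun p _ => zero_le⟩
  | succ n ih =>
    have he : ∀ p ∈ A, iter1 A (2 * n + 1 + 1) p ≤ h p :=
      fun p hp => (T1_anti ih.2 p).trans (hfix hp).le
    exact ⟨he, step _ he⟩

/-- Proposition 4.11: the limit `f` of the even `T₁`-iterates is a GMHS function of
Type 1 iff `f = g`, in which case it is the unique GMHS function of Type 1. -/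
theorem statement8 (A : Set MPt) (hA : MarkedLocFin A) (hD : CondD A) :
    (IsGMHS1 A (limEven1 A) ↔ Set.EqOn (limEven1 A) (limOdd1 A) A) ∧
    (Set.EqOn (limEven1 A) (limOdd1 A) A →
      ∀ h : MPt → ℝ≥0∞, IsGMHS1 A h → Set.EqOn h (limEven1 A) A) := by
  refine ⟨?_, fun hfg h hh p hp => ?_⟩
  · rw [isGMHS1_iff hA hD]
    exact ⟨fun hf p hp => (hf hp).symm.trans (T1_limEven1 A p),
      fun hf p hp => (T1_limEven1 A p).trans (hf hp).symm⟩
  · have hb := iter1_bounds ((isGMHS1_iff hA hD h).1 hh)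
    refine le_antisymm ?_ (iSup_le fun n => (hb n).1 p hp)
    rw [hfg hp]
    exact le_iInf fun n => (hb n).2 p hp

end Lilypond
end
end

section
/- Let P_Θ be a locally finite marked point set in ℝ² satisfying Conditions D, and let f∈𝓕 satisfy T₂f = f. Then f is a GMHS function of Type 2: f is a hard-segment function and every Pᶿᵢ∈P_Θ with f(Pᶿᵢ) < ∞ has a Type 2 stopping segment neighbour. -/
open scoped ENNReal
open Real

noncomputable section

namespace Lilypond

theorem norm_dirVec (θ : ℝ) : ‖dirVec θ‖ = 1 := by
  simp [dirVec, EuclideanSpace.norm_eq]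

theorem S0_subset_lineThru (p : MPt) (r : ℝ≥0∞) : S0 p r ⊆ lineThru p := by
  rintro q ⟨t, -, rfl⟩
  exact ⟨t, rfl⟩

theorem edist_lt_of_mem_S0 {p : MPt} {r : ℝ≥0∞} {q : Pt} (hq : q ∈ S0 p r) :
    edist p.1 q < r := by
  obtain ⟨t, ht, rfl⟩ := hq
  rwa [edist_add_smul_dirVec]

/-- Lines with distinct directions in `[0, π)` meet in at most one point. -/
theorem eq_of_mem_lineThru {i j : MPt} (hi : i.2 ∈ Set.Ico 0 π) (hj : j.2 ∈ Set.Ico 0 π)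
    (hij : i.2 ≠ j.2) {x y : Pt} (hxi : x ∈ lineThru i) (hxj : x ∈ lineThru j)
    (hyi : y ∈ lineThru i) (hyj : y ∈ lineThru j) : x = y := by
  obtain ⟨t, rfl⟩ := hxi
  obtain ⟨s, hs⟩ := hxj
  obtain ⟨t', rfl⟩ := hyi
  obtain ⟨s', hs'⟩ := hyj
  have h0 := congrArg (fun v : Pt => v 0) hs
  have h1 := congrArg (fun v : Pt => v 1) hs
  have h0' := congrArg (fun v : Pt => v 0) hs'
  have h1' := congrArg (fun v : Pt => v 1) hs'
  simp [dirVec] at h0 h1 h0' h1'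
  have hsin : Real.sin (i.2 - j.2) ≠ 0 := by
    rw [Ne, Real.sin_eq_zero_iff_of_lt_of_lt (by linarith [hi.1, hj.2]) (by linarith [hi.2, hj.1]),
      sub_eq_zero]
    exact hij
  have hmul : (t - t') * Real.sin (i.2 - j.2) = 0 := by
    rw [Real.sin_sub]
    linear_combination (Real.cos j.2) * (h1 - h1') - (Real.sin j.2) * (h0 - h0')
  have ht : t = t' := sub_eq_zero.mp ((mul_eq_zero.mp hmul).resolve_right hsin)
  rw [ht]

theorem mem_lineThru_symm {i j : MPt} (hij : i.2 = j.2) (h : j.1 ∈ lineThru i) :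
    i.1 ∈ lineThru j := by
  obtain ⟨t, ht⟩ := h
  exact ⟨-t, by rw [ht, hij]; module⟩

theorem dD_of_mem_lineThru {i j : MPt} (hij : i.2 = j.2) (h : j.1 ∈ lineThru i) :
    dD i j = edist i.1 j.1 / 2 := by
  rw [dD, if_pos hij, if_pos h]

/-- Under Conditions D, distinct marked points with equal directions lie on distinct lines. -/
theorem CondD.notMem_lineThru {A : Set MPt} (hD : CondD A) {i j : MPt} (hi : i ∈ A) (hj : j ∈ A)
    (hne : i ≠ j) (hij : i.2 = j.2) : j.1 ∉ lineThru i := by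
  intro h
  have h₁ := dD_of_mem_lineThru hij h
  have h₂ := dD_of_mem_lineThru hij.symm (mem_lineThru_symm hij h)
  have hfin (a b : Pt) : edist a b / 2 ≠ ⊤ :=
    ENNReal.div_ne_top (edist_ne_top _ _) two_ne_zero
  refine hD i hi j hj j hj i hi hne hne.symm (fun h => hne (Prod.ext_iff.mp h).1)
    (h₁ ▸ hfin _ _) (h₂ ▸ hfin _ _) ?_
  rw [h₁, h₂, edist_comm]

/-- Under Conditions D, a common point of two lines realises the distances `dᵢⱼ`. -/
theorem CondD.dD_eq_edist {A : Set MPt} (hA : MarkedLocFin A) (hD : CondD A) {i j : MPt}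
    (hi : i ∈ A) (hj : j ∈ A) (hne : i ≠ j) {x : Pt} (hxi : x ∈ lineThru i)
    (hxj : x ∈ lineThru j) : dD i j = edist i.1 x := by
  have hij : i.2 ≠ j.2 := by
    intro hij
    refine hD.notMem_lineThru hi hj hne hij ?_
    obtain ⟨t, rfl⟩ := hxi
    obtain ⟨s, hs⟩ := hxj
    rw [← hij] at hs
    exact ⟨t - s, by rw [sub_smul, ← add_sub_assoc, hs, add_sub_cancel_right]⟩
  have hmeet : (lineThru i ∩ lineThru j).Nonempty := ⟨x, hxi, hxj⟩
  have hmem : interPt i j ∈ lineThru i ∩ lineThru j := by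
    rw [interPt, dif_pos hmeet]
    exact hmeet.choose_spec
  rw [dD, if_neg hij,
    eq_of_mem_lineThru (hA.1 i hi) (hA.1 j hj) hij hmem.1 hmem.2 hxi hxj]

theorem MarkedLocFin.finite_max_dD_le {A : Set MPt} (hA : MarkedLocFin A) (i : MPt) {c : ℝ≥0∞}
    (hc : c ≠ ⊤) : {j ∈ A | max (dD i j) (dD j i) ≤ c}.Finite := by
  refine (hA.2 (Metric.closedBall i.1 (c + c).toReal) Metric.isBounded_closedBall).subset ?_
  rintro j ⟨hj, hjc⟩
  refine ⟨hj, ?_⟩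
  rw [Metric.mem_closedBall, dist_edist, edist_comm]
  exact ENNReal.toReal_mono (ENNReal.add_ne_top.mpr ⟨hc, hc⟩) ((edist_le_dD_add_dD i j).trans
    (add_le_add ((le_max_left _ _).trans hjc) ((le_max_right _ _).trans hjc)))

/-- A finite value of `T₂ f` is attained. -/
theorem MarkedLocFin.T2_mem_D2 {A : Set MPt} (hA : MarkedLocFin A) {f : MPt → ℝ≥0∞} {i : MPt}
    (h : T2 A f i < ⊤) : T2 A f i ∈ D2 A f i := by
  obtain ⟨c, hc, hctop⟩ := sInf_lt_iff.mp h
  have hfin : (D2 A f i ∩ Set.Iic c).Finite := by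
    refine ((hA.finite_max_dD_le i hctop.ne).image fun j => max (dD i j) (dD j i)).subset ?_
    rintro x ⟨⟨j, hj, -, rfl, -⟩, hx⟩
    exact ⟨j, ⟨hj, hx⟩, rfl⟩
  obtain ⟨m, ⟨hm, hmc⟩, hmin⟩ := Set.exists_min_image _ id hfin ⟨c, hc, le_refl c⟩
  have hleast : IsLeast (D2 A f i) m := by
    refine ⟨hm, fun x hx => ?_⟩
    rcases le_total x c with hxc | hcx
    · exact hmin x ⟨hx, hxc⟩
    · exact hmc.trans hcx
  rw [T2, hleast.csInf_eq]
  exact hm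

/-- Lemma 4.18: a fixed point of `T₂` is a GMHS function of Type 2: it is a hard-segment
function and every marked point with finite value has a Type 2 stopping segment
neighbour. -/
theorem statement15 (A : Set MPt) (hA : MarkedLocFin A) (hD : CondD A)
    (f : MPt → ℝ≥0∞) (hfix : Set.EqOn (T2 A f) f A) :
    IsHS A f ∧ ∀ i ∈ A, f i < ⊤ → ∃ j, StopNbr2 A f i j := by
  constructor
  · intro i hi j hj hne
    rw [Set.disjoint_left]
    intro x hxi hxj
    have hi_line := S0_subset_lineThru _ _ hxi
    have hj_line := S0_subset_lineThru _ _ hxj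
    have hij : dD i j < f i := by
      rw [hD.dD_eq_edist hA hi hj hne hi_line hj_line]
      exact edist_lt_of_mem_S0 hxi
    have hji : dD j i < f j := by
      rw [hD.dD_eq_edist hA hj hi hne.symm hj_line hi_line]
      exact edist_lt_of_mem_S0 hxj
    have hfi : f i ≤ max (dD i j) (dD j i) := by
      rw [← hfix hi]
      exact sInf_le ⟨j, hj, hne.symm, rfl, hji.le⟩
    have hfj : f j ≤ max (dD j i) (dD i j) := by
      rw [← hfix hj]
      exact sInf_le ⟨i, hi, hne, rfl, hij.le⟩
    rcases le_max_iff.mp hfi with h | h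
    · exact hij.not_ge h
    · rcases le_max_iff.mp hfj with h' | h'
      · exact hji.not_ge h'
      · exact (hij.trans_le h).not_ge (hji.le.trans h')
  · intro i hi hfi
    rw [← hfix hi] at hfi
    obtain ⟨j, hj, hne, hval, hle⟩ := hA.T2_mem_D2 hfi
    exact ⟨j, hj, hne, (hfix hi).symm.trans hval, hle⟩

end Lilypond
end
end
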